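/- Let A and B be unital associative algebras over a field K, let γ be a K-algebra automorphism of B, let t be a γ-twisted trace on B, and let τ : A^(k+1) → K be a Hochschild k-cocycle on A (i.e. b τ = 0 for the untwisted Hochschild coboundary). Then there is a unique K-multilinear map τ^γ : (A ⊗_K B)^(k+1) → K satisfying τ^γ(a₀⊗b₀, …, a_k⊗b_k) = τ(a₀,…,a_k)·t(b₀·b₁⋯b_k) on pure tensors, and τ^γ is a (id_A ⊗ γ)-twisted Hochschild k-cocycle on the tensor product algebra A ⊗_K B, where id_A ⊗ γ denotes the algebra automorphism a⊗b ↦ a⊗γ(b). -/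

import Mathlib

open TensorProduct

/-- The `γ`-twisted Hochschild coboundary of a `p`-cochain `f : A^(p+1) → K`. -/
def twistedHochschildCoboundary {K A : Type*} [Ring K] [Mul A] (γ : A → A) (p : ℕ)
    (f : (Fin (p + 1) → A) → K) : (Fin (p + 2) → A) → K :=
  fun a =>
    (∑ i : Fin (p + 1), (-1 : K) ^ (i : ℕ) *
      f (fun j => if (j : ℕ) < (i : ℕ) then a j.castSucc
                  else if (j : ℕ) = (i : ℕ) then a j.castSucc * a j.succ
                  else a j.succ))
    + (-1 : K) ^ (p + 1) *
      f (fun j => if j = 0 then γ (a (Fin.last (p + 1))) * a 0 else a j.castSucc)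

namespace MultilinearMap

section CommSemiring

variable {R M N P Q : Type*} [CommSemiring R] [AddCommMonoid M] [Module R M]
  [AddCommMonoid N] [Module R N] [AddCommMonoid P] [Module R P] [AddCommMonoid Q] [Module R Q]

/-- Multilinear maps on a tensor product that agree on families of pure tensors are equal. -/
theorem ext_tmul {n : ℕ} {f g : MultilinearMap R (fun _ : Fin n => M ⊗[R] N) P}
    (h : ∀ (a : Fin n → M) (b : Fin n → N),
      f (fun i => a i ⊗ₜ[R] b i) = g (fun i => a i ⊗ₜ[R] b i)) : f = g := by
  induction n with
  | zero =>
    ext x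
    convert h 0 0
  | succ n ih =>
    apply (multilinearCurryLeftEquiv R (fun _ : Fin (n + 1) => M ⊗[R] N) P).injective
    refine TensorProduct.ext' fun a b => ih fun a' b' => ?_
    have hcons : (Fin.cons (a ⊗ₜ[R] b) fun i => a' i ⊗ₜ[R] b' i : Fin (n + 1) → M ⊗[R] N) =
        fun i => (Fin.cons a a' : Fin (n + 1) → M) i ⊗ₜ[R] (Fin.cons b b' : Fin (n + 1) → N) i := by
      funext i
      cases i using Fin.cases <;> rfl
    change f (Fin.cons _ _) = g (Fin.cons _ _)
    rw [hcons]
    exact h _ _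

/-- The external product of `n`-linear maps on `M` and on `N`, as an `n`-linear map on
`M ⊗[R] N`. -/
theorem exists_externalProduct (n : ℕ) :
    ∃ E : MultilinearMap R (fun _ : Fin n => M) P ⊗[R] MultilinearMap R (fun _ : Fin n => N) Q →ₗ[R]
        MultilinearMap R (fun _ : Fin n => M ⊗[R] N) (P ⊗[R] Q),
      ∀ f g (a : Fin n → M) (b : Fin n → N),
        E (f ⊗ₜ g) (fun i => a i ⊗ₜ[R] b i) = f a ⊗ₜ[R] g b := by
  induction n with
  | zero =>
    refine ⟨(constLinearEquivOfIsEmpty R R (fun _ : Fin 0 => M ⊗[R] N) (P ⊗[R] Q)).toLinearMap ∘ₗ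
      TensorProduct.map (constLinearEquivOfIsEmpty R R (fun _ : Fin 0 => M) P).symm.toLinearMap
        (constLinearEquivOfIsEmpty R R (fun _ : Fin 0 => N) Q).symm.toLinearMap,
      fun f g a b => ?_⟩
    rw [Subsingleton.elim a 0, Subsingleton.elim b 0]
    rfl
  | succ n ih =>
    obtain ⟨E, hE⟩ := ih
    refine ⟨(multilinearCurryLeftEquiv R (fun _ : Fin (n + 1) => M ⊗[R] N)
        (P ⊗[R] Q)).symm.toLinearMap ∘ₗ LinearMap.compRight R E ∘ₗ
      TensorProduct.homTensorHomMap (RingHom.id R) M N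
        (MultilinearMap R (fun _ : Fin n => M) P) (MultilinearMap R (fun _ : Fin n => N) Q) ∘ₗ
      TensorProduct.map (multilinearCurryLeftEquiv R (fun _ : Fin (n + 1) => M) P).toLinearMap
        (multilinearCurryLeftEquiv R (fun _ : Fin (n + 1) => N) Q).toLinearMap,
      fun f g a b => ?_⟩
    refine (hE (f.curryLeft (a 0)) (g.curryLeft (b 0)) (Fin.tail a) (Fin.tail b)).trans ?_
    simp

/-- Precomposition of a multilinear map with a map of families that turns an update of one
coordinate into a linear update of one coordinate. -/
def compOfUpdate {ι κ : Type*} [DecidableEq ι] [DecidableEq κ]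
    (f : MultilinearMap R (fun _ : κ => N) P) (φ : (ι → M) → κ → N)
    (hφ : ∀ a i, ∃ j, ∃ L : M →ₗ[R] N, ∀ x,
      φ (Function.update a i x) = Function.update (φ a) j (L x)) :
    MultilinearMap R (fun _ : ι => M) P :=
  MultilinearMap.mk' (fun a => f (φ a))
    (fun a i x y => by
      obtain ⟨j, L, hL⟩ := hφ a i
      simp [hL])
    (fun a i c x => by
      obtain ⟨j, L, hL⟩ := hφ a i
      simp [hL])

end CommSemiring

end MultilinearMap

namespace Fin

theorem exists_contractNth_update {K A : Type*} [CommSemiring K] [Semiring A] [Algebra K A]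
    {n : ℕ} (i : Fin n) (a : Fin (n + 1) → A) (m : Fin (n + 1)) :
    ∃ j, ∃ L : A →ₗ[K] A, ∀ x,
      contractNth i.castSucc (· * ·) (Function.update a m x) =
        Function.update (contractNth i.castSucc (· * ·) a) j (L x) := by
  have of_update (j : Fin n) (L : A →ₗ[K] A)
      (hj : ∀ x, contractNth i.castSucc (· * ·) (Function.update a m x) j = L x)
      (hne : ∀ x l, l ≠ j → contractNth i.castSucc (· * ·) (Function.update a m x) l =
        contractNth i.castSucc (· * ·) a l) :
      ∃ j, ∃ L : A →ₗ[K] A, ∀ x,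
        contractNth i.castSucc (· * ·) (Function.update a m x) =
          Function.update (contractNth i.castSucc (· * ·) a) j (L x) := by
    refine ⟨j, L, fun x => funext fun l => ?_⟩
    by_cases hl : l = j
    · subst hl; simp [hj]
    · simp [hl, hne]
  rcases lt_trichotomy m i.castSucc with h | rfl | h
  · refine of_update (m.castLT (by grind)) LinearMap.id (fun x => ?_) (fun x l hl => ?_) <;>
      grind [contractNth, Function.update_apply, LinearMap.id_apply]
  · refine of_update i (LinearMap.mulRight K (a i.succ)) (fun x => ?_) (fun x l hl => ?_) <;>
      grind [contractNth, Function.update_apply, LinearMap.mulRight_apply]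
  · by_cases h' : m = i.succ
    · subst h'
      refine of_update i (LinearMap.mulLeft K (a i.castSucc)) (fun x => ?_) (fun x l hl => ?_) <;>
        grind [contractNth, Function.update_apply, LinearMap.mulLeft_apply]
    · refine of_update (m.pred (by grind)) LinearMap.id (fun x => ?_) (fun x l hl => ?_) <;>
        grind [contractNth, Function.update_apply, LinearMap.id_apply]

theorem prod_ofFn_contractNth {B : Type*} [Monoid B] {n : ℕ} (i : Fin n) (b : Fin (n + 1) → B) :
    (List.ofFn (contractNth i.castSucc (· * ·) b)).prod = (List.ofFn b).prod := by
  induction n with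
  | zero => exact i.elim0
  | succ n ih =>
    cases i using Fin.cases with
    | zero =>
      simp [List.ofFn_succ, contractNth, mul_assoc]
    | succ i =>
      have htail : (fun l : Fin n => contractNth i.succ.castSucc (· * ·) b l.succ) =
          contractNth i.castSucc (· * ·) (fun l => b l.succ) := by
        funext l
        simp [contractNth]
      rw [List.ofFn_succ, htail, List.prod_cons, ih, List.ofFn_succ (f := b), List.prod_cons]
      simp [contractNth]

end Fin

section TwistedHochschild

/-- The arguments of the cyclic face of the `γ`-twisted Hochschild coboundary. -/
def twistedCyclicFace {A : Type*} [Mul A] (γ : A → A) {n : ℕ} (a : Fin (n + 2) → A) :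
    Fin (n + 1) → A :=
  fun j => if j = 0 then γ (a (Fin.last (n + 1))) * a 0 else a j.castSucc

theorem twistedHochschildCoboundary_apply {K A : Type*} [Ring K] [Mul A] (γ : A → A) (p : ℕ)
    (f : (Fin (p + 1) → A) → K) (a : Fin (p + 2) → A) :
    twistedHochschildCoboundary γ p f a =
      (∑ i : Fin (p + 1), (-1 : K) ^ (i : ℕ) * f (Fin.contractNth i.castSucc (· * ·) a)) +
        (-1 : K) ^ (p + 1) * f (twistedCyclicFace γ a) :=
  rfl

theorem exists_twistedCyclicFace_update {K A : Type*} [CommSemiring K] [Semiring A] [Algebra K A]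
    (γ : A →ₗ[K] A) {n : ℕ} (a : Fin (n + 2) → A) (m : Fin (n + 2)) :
    ∃ j, ∃ L : A →ₗ[K] A, ∀ x,
      twistedCyclicFace γ (Function.update a m x) =
        Function.update (twistedCyclicFace γ a) j (L x) := by
  cases m using Fin.lastCases with
  | last =>
    refine ⟨0, LinearMap.mulRight K (a 0) ∘ₗ γ, fun x => funext fun l => ?_⟩
    by_cases hl : l = 0
    · subst hl; simp [twistedCyclicFace, Fin.ext_iff]
    · simp [twistedCyclicFace, hl, Fin.castSucc_ne_last]
  | cast m =>
    by_cases hm : m = 0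
    · subst hm
      refine ⟨0, LinearMap.mulLeft K (γ (a (Fin.last _))), fun x => funext fun l => ?_⟩
      by_cases hl : l = 0
      · subst hl; simp [twistedCyclicFace, Fin.ext_iff]
      · simp [twistedCyclicFace, hl]
    · refine ⟨m, LinearMap.id, fun x => funext fun l => ?_⟩
      by_cases hl : l = 0
      · subst hl
        simp [twistedCyclicFace, Fin.ext_iff, Ne.symm hm,
          (Fin.val_ne_zero_iff.mpr hm).symm, m.isLt.ne']
      · simp [twistedCyclicFace, Function.update_apply, hl]

variable {K A B : Type*} [CommRing K] [Ring A] [Algebra K A] [Ring B] [Algebra K B]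

/-- The twisted Hochschild coboundary of a multilinear cochain, as a multilinear map. -/
def MultilinearMap.twistedHochschildCoboundary (γ : A →ₗ[K] A) (p : ℕ)
    (f : MultilinearMap K (fun _ : Fin (p + 1) => A) K) :
    MultilinearMap K (fun _ : Fin (p + 2) => A) K :=
  (∑ i : Fin (p + 1), (-1 : K) ^ (i : ℕ) •
      f.compOfUpdate (Fin.contractNth i.castSucc (· * ·)) (Fin.exists_contractNth_update i)) +
    (-1 : K) ^ (p + 1) • f.compOfUpdate (twistedCyclicFace γ) (exists_twistedCyclicFace_update γ)

theorem MultilinearMap.coe_twistedHochschildCoboundary (γ : A →ₗ[K] A) (p : ℕ)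
    (f : MultilinearMap K (fun _ : Fin (p + 1) => A) K) :
    ⇑(f.twistedHochschildCoboundary γ p) = _root_.twistedHochschildCoboundary γ p f := by
  funext a
  simp [MultilinearMap.twistedHochschildCoboundary, twistedHochschildCoboundary_apply,
    MultilinearMap.compOfUpdate]

theorem contractNth_tmul {n : ℕ} (i : Fin (n + 1)) (a : Fin (n + 1) → A) (b : Fin (n + 1) → B) :
    Fin.contractNth i (· * ·) (fun l => a l ⊗ₜ[K] b l) =
      fun l => Fin.contractNth i (· * ·) a l ⊗ₜ[K] Fin.contractNth i (· * ·) b l := by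
  funext l
  simp only [Fin.contractNth]
  split_ifs <;> simp

theorem twistedCyclicFace_tmul (α : A ≃ₐ[K] A) (γ : B ≃ₐ[K] B) {n : ℕ}
    (a : Fin (n + 2) → A) (b : Fin (n + 2) → B) :
    twistedCyclicFace (Algebra.TensorProduct.congr α γ) (fun l => a l ⊗ₜ[K] b l) =
      fun l => twistedCyclicFace α a l ⊗ₜ[K] twistedCyclicFace γ b l := by
  funext l
  simp only [twistedCyclicFace]
  split_ifs <;> simp

theorem twistedTrace_prod_twistedCyclicFace {K B : Type*} [Monoid B] (γ : B → B) (t : B → K)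
    (ht : ∀ b₁ b₂ : B, t (b₁ * b₂) = t (γ b₂ * b₁)) {n : ℕ} (b : Fin (n + 2) → B) :
    t (List.ofFn (twistedCyclicFace γ b)).prod = t (List.ofFn b).prod := by
  rw [List.ofFn_succ' (f := b), List.concat_eq_append, List.prod_append, List.prod_singleton, ht,
    List.ofFn_succ, List.ofFn_succ (n := n)]
  simp [twistedCyclicFace, mul_assoc]

end TwistedHochschild

/-- Given a Hochschild `k`-cocycle `τ` on `A` and a `γ`-twisted trace `t` on `B`, there is a
unique `K`-multilinear map `τ^γ` on `(A ⊗[K] B)^(k+1)` with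
`τ^γ(a₀⊗b₀,…,a_k⊗b_k) = τ(a₀,…,a_k) ⬝ t(b₀⋯b_k)` on pure tensors, and `τ^γ` is an
`(id_A ⊗ γ)`-twisted Hochschild `k`-cocycle on `A ⊗[K] B`. -/
theorem exists_unique_twisted_external_product_cocycle
    {K A B : Type*} [Field K] [Ring A] [Algebra K A] [Ring B] [Algebra K B]
    (γ : B ≃ₐ[K] B) (t : B →ₗ[K] K)
    (ht : ∀ b₁ b₂ : B, t (b₁ * b₂) = t (γ b₂ * b₁))
    (k : ℕ) (τ : MultilinearMap K (fun _ : Fin (k + 1) => A) K)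
    (hτ : twistedHochschildCoboundary (id : A → A) k ⇑τ = 0) :
    ∃ F : MultilinearMap K (fun _ : Fin (k + 1) => A ⊗[K] B) K,
      (∀ (a : Fin (k + 1) → A) (b : Fin (k + 1) → B),
        F (fun i => a i ⊗ₜ[K] b i) = τ a * t ((List.ofFn b).prod)) ∧
      twistedHochschildCoboundary
        (⇑(Algebra.TensorProduct.congr (AlgEquiv.refl : A ≃ₐ[K] A) γ)) k ⇑F = 0 ∧
      (∀ F' : MultilinearMap K (fun _ : Fin (k + 1) => A ⊗[K] B) K,
        (∀ (a : Fin (k + 1) → A) (b : Fin (k + 1) → B),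
          F' (fun i => a i ⊗ₜ[K] b i) = τ a * t ((List.ofFn b).prod)) → F' = F) := by
  obtain ⟨E, hE⟩ := MultilinearMap.exists_externalProduct (R := K) (M := A) (N := B) (P := K)
    (Q := K) (k + 1)
  set F : MultilinearMap K (fun _ : Fin (k + 1) => A ⊗[K] B) K :=
    (TensorProduct.lid K K).toLinearMap.compMultilinearMap
      (E (τ ⊗ₜ t.compMultilinearMap (MultilinearMap.mkPiAlgebraFin K (k + 1) B)))
  have hF (a : Fin (k + 1) → A) (b : Fin (k + 1) → B) :
      F (fun i => a i ⊗ₜ[K] b i) = τ a * t ((List.ofFn b).prod) := by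
    simp [F, hE]
  refine ⟨F, hF, ?_, fun F' hF' => MultilinearMap.ext_tmul fun a b => (hF' a b).trans (hF a b).symm⟩
  set Γ := Algebra.TensorProduct.congr (AlgEquiv.refl : A ≃ₐ[K] A) γ
  suffices h : F.twistedHochschildCoboundary Γ.toLinearMap k = 0 by
    exact (F.coe_twistedHochschildCoboundary Γ.toLinearMap k).symm.trans (congrArg (⇑) h)
  refine MultilinearMap.ext_tmul fun a b => ?_
  rw [MultilinearMap.coe_twistedHochschildCoboundary]
  have hτab := congrFun hτ a
  rw [twistedHochschildCoboundary_apply] at hτab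
  change twistedHochschildCoboundary Γ k F _ = 0
  rw [twistedHochschildCoboundary_apply, twistedCyclicFace_tmul, hF,
    twistedTrace_prod_twistedCyclicFace γ t ht]
  simp only [contractNth_tmul, hF, Fin.prod_ofFn_contractNth, ← mul_assoc, ← Finset.sum_mul,
    ← add_mul]
  exact mul_eq_zero_of_left hτab _
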